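/- Let G be a finite simple connected non-bipartite graph on n vertices, and let μ ∈ [0,1) be such that every eigenvalue of Â_r = Â − z₁z₁ᵀ lies in [−μ, μ]. Let σ₂ be the second-smallest eigenvalue of the (unnormalized) Laplacian L (the spectral gap). Consider a GNN of depth r with ‖∇φ_l‖ ≤ α and max{‖∇ψ_l‖, 1} ≤ β for all l, and set d_min = min_{v∈V} d_v and d_max = max_{v∈V} d_v. Then the sum over all ordered pairs of distinct vertices u ≠ v of ‖∂h_u^{(r)}/∂x_v‖ is at most (2αβ)^r · (d_max/2) · ( (n(n−1)/d_min)·( r + 1 + μ^{r+1}/(1−μ) ) − 1/(n σ₂) ). -/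

import Mathlib

open Matrix Finset

/-- The normalized adjacency matrix `Â = D^{-1/2} A D^{-1/2}` of a graph. -/
noncomputable def nadj {V : Type*} [Fintype V] [DecidableEq V] (G : SimpleGraph V)
    [DecidableRel G.Adj] : Matrix V V ℝ :=
  Matrix.diagonal (fun v => (Real.sqrt (G.degree v))⁻¹) * G.adjMatrix ℝ *
    Matrix.diagonal (fun v => (Real.sqrt (G.degree v))⁻¹)

/-- The unit eigenvector `z₁` of `Â` with eigenvalue `1`: `z₁(v) = √(d_v/(2m))`. -/
noncomputable def zOne {V : Type*} [Fintype V] [DecidableEq V] (G : SimpleGraph V)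
    [DecidableRel G.Adj] : V → ℝ :=
  fun v => Real.sqrt ((G.degree v : ℝ) / (2 * (G.edgeFinset.card : ℝ)))

/-- `Â_r = Â − z₁z₁ᵀ`, the restriction of `Â` to the orthogonal complement of `z₁`. -/
noncomputable def nadjr {V : Type*} [Fintype V] [DecidableEq V] (G : SimpleGraph V)
    [DecidableRel G.Adj] : Matrix V V ℝ :=
  nadj G - Matrix.vecMulVec (zOne G) (zOne G)

/-- The GNN iteration: `h⁰_v(X) = X v` and
`h^{l+1}_v(X) = φ_l (h^l_v(X), Σ_u Â_{uv} ψ_l (h^l_u(X)))`. -/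
noncomputable def gnn {V : Type*} [Fintype V] [DecidableEq V] (G : SimpleGraph V)
    [DecidableRel G.Adj] (d : ℕ)
    (φ : ℕ → WithLp 2 (EuclideanSpace ℝ (Fin d) × EuclideanSpace ℝ (Fin d)) →
      EuclideanSpace ℝ (Fin d))
    (ψ : ℕ → EuclideanSpace ℝ (Fin d) → EuclideanSpace ℝ (Fin d)) :
    ℕ → (V → EuclideanSpace ℝ (Fin d)) → V → EuclideanSpace ℝ (Fin d)
  | 0, X, v => X v
  | (l + 1), X, v =>
      φ l ((WithLp.equiv 2 _).symm
        (gnn G d φ ψ l X v, ∑ u : V, nadj G u v • ψ l (gnn G d φ ψ l X u)))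

section NormalizedAdjacency

variable {V : Type*} [Fintype V] [DecidableEq V] (G : SimpleGraph V) [DecidableRel G.Adj]

lemma nadj_apply (u v : V) :
    nadj G u v = (Real.sqrt (G.degree u))⁻¹ * G.adjMatrix ℝ u v * (Real.sqrt (G.degree v))⁻¹ := by
  rw [nadj, Matrix.mul_diagonal, Matrix.diagonal_mul]

lemma nadj_nonneg (u v : V) : 0 ≤ nadj G u v := by
  rw [nadj_apply, SimpleGraph.adjMatrix_apply]
  positivity

lemma nadj_comm (u v : V) : nadj G u v = nadj G v u := by
  simp only [nadj_apply, SimpleGraph.adjMatrix_apply, G.adj_comm u v]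
  ring

lemma sum_sq_nadj_mulVec_le (x : V → ℝ) :
    ∑ u, (nadj G *ᵥ x) u ^ 2 ≤ ∑ u, x u ^ 2 := by
  have hrow (u : V) : (nadj G *ᵥ x) u ^ 2 ≤
      ∑ w, if G.Adj u w then (G.degree w : ℝ)⁻¹ * x w ^ 2 else 0 := by
    have hu : (nadj G *ᵥ x) u = (Real.sqrt (G.degree u))⁻¹ *
        ∑ w ∈ G.neighborFinset u, (Real.sqrt (G.degree w))⁻¹ * x w := by
      rw [SimpleGraph.neighborFinset_eq_filter, Finset.sum_filter, Finset.mul_sum, Matrix.mulVec,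
        dotProduct]
      refine Finset.sum_congr rfl fun w _ => ?_
      rw [nadj_apply, SimpleGraph.adjMatrix_apply]
      split_ifs <;> ring
    have hcs := sq_sum_le_card_mul_sum_sq (s := G.neighborFinset u)
      (f := fun w => (Real.sqrt (G.degree w))⁻¹ * x w)
    rw [SimpleGraph.card_neighborFinset_eq_degree] at hcs
    simp only [mul_pow, inv_pow, Real.sq_sqrt (Nat.cast_nonneg _)] at hcs
    rw [hu, mul_pow, inv_pow, Real.sq_sqrt (Nat.cast_nonneg _), ← Finset.sum_filter,
      ← SimpleGraph.neighborFinset_eq_filter]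
    have hS : 0 ≤ ∑ w ∈ G.neighborFinset u, (G.degree w : ℝ)⁻¹ * x w ^ 2 :=
      Finset.sum_nonneg fun w _ => by positivity
    calc _ ≤ (G.degree u : ℝ)⁻¹ * ((G.degree u : ℝ) *
          ∑ w ∈ G.neighborFinset u, (G.degree w : ℝ)⁻¹ * x w ^ 2) := by gcongr
      _ = ((G.degree u : ℝ)⁻¹ * (G.degree u : ℝ)) *
          ∑ w ∈ G.neighborFinset u, (G.degree w : ℝ)⁻¹ * x w ^ 2 := by ring
      _ ≤ _ := mul_le_of_le_one_left hS inv_mul_le_one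
  refine (Finset.sum_le_sum fun u _ => hrow u).trans ?_
  rw [Finset.sum_comm]
  refine Finset.sum_le_sum fun w _ => ?_
  rw [← Finset.sum_filter, Finset.sum_const, nsmul_eq_mul]
  have hdeg : (Finset.univ.filter fun u => G.Adj u w).card = G.degree w := by
    simp only [G.adj_comm _ w]
    rw [← SimpleGraph.neighborFinset_eq_filter, SimpleGraph.card_neighborFinset_eq_degree]
  rw [hdeg, ← mul_assoc]
  exact mul_le_of_le_one_left (sq_nonneg _) mul_inv_le_one

lemma one_add_nadj_pow_nonneg (l : ℕ) (u v : V) : 0 ≤ ((1 + nadj G) ^ l) u v := by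
  induction l generalizing u v with
  | zero => rw [pow_zero, Matrix.one_apply]; positivity
  | succ l ih =>
    rw [pow_succ, Matrix.mul_apply]
    refine Finset.sum_nonneg fun w _ => mul_nonneg (ih u w) ?_
    rw [Matrix.add_apply, Matrix.one_apply]
    have := nadj_nonneg G w v
    positivity

lemma sum_sq_one_add_nadj_pow_mulVec_le (l : ℕ) (x : V → ℝ) :
    ∑ u, ((1 + nadj G) ^ l *ᵥ x) u ^ 2 ≤ 4 ^ l * ∑ u, x u ^ 2 := by
  induction l with
  | zero => simp
  | succ l ih =>
    set y := (1 + nadj G) ^ l *ᵥ x with hy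
    have hstep : (1 + nadj G) ^ (l + 1) *ᵥ x = y + nadj G *ᵥ y := by
      rw [pow_succ', ← Matrix.mulVec_mulVec, ← hy, Matrix.add_mulVec, Matrix.one_mulVec]
    rw [hstep]
    have hle : ∑ u, (y + nadj G *ᵥ y) u ^ 2 ≤
        2 * ∑ u, y u ^ 2 + 2 * ∑ u, (nadj G *ᵥ y) u ^ 2 := by
      rw [Finset.mul_sum, Finset.mul_sum, ← Finset.sum_add_distrib]
      refine Finset.sum_le_sum fun u _ => ?_
      rw [Pi.add_apply]
      nlinarith [sq_nonneg (y u - (nadj G *ᵥ y) u)]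
    have := sum_sq_nadj_mulVec_le G y
    rw [pow_succ]
    linarith

lemma sum_one_add_nadj_pow_le (l : ℕ) :
    ∑ u, ∑ v, ((1 + nadj G) ^ l) u v ≤ 2 ^ l * (Fintype.card V : ℝ) := by
  have h := sum_sq_one_add_nadj_pow_mulVec_le G l (fun _ => 1)
  have hcs := sq_sum_le_card_mul_sum_sq (s := (Finset.univ : Finset V))
      (f := fun u => ((1 + nadj G) ^ l *ᵥ fun _ => 1) u)
  have hsum : ∑ u, ((1 + nadj G) ^ l *ᵥ fun _ => 1) u = ∑ u, ∑ v, ((1 + nadj G) ^ l) u v := by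
    simp [Matrix.mulVec, dotProduct]
  rw [hsum] at hcs
  simp only [one_pow, Finset.sum_const, nsmul_eq_mul, mul_one, Finset.card_univ] at h hcs
  refine le_of_sq_le_sq ?_ (by positivity)
  calc _ ≤ _ := hcs
    _ ≤ (Fintype.card V : ℝ) * (4 ^ l * (Fintype.card V : ℝ)) := by gcongr
    _ = _ := by rw [mul_pow, ← pow_mul, mul_comm l 2, pow_mul]; norm_num; ring

end NormalizedAdjacency

section LaplacianGap

variable {V : Type*} {G : SimpleGraph V}

/-- The squared difference of a vertex function across an unordered pair. -/
def sqDiff (f : V → ℝ) : Sym2 V → ℝ :=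
  Sym2.lift ⟨fun a b => (f a - f b) ^ 2, fun a b => by ring⟩

@[simp] lemma sqDiff_mk (f : V → ℝ) (a b : V) : sqDiff f s(a, b) = (f a - f b) ^ 2 := rfl

lemma sqDiff_nonneg (f : V → ℝ) (e : Sym2 V) : 0 ≤ sqDiff f e := by
  induction e with
  | h a b => exact sq_nonneg _

lemma SimpleGraph.Walk.sq_sub_le_length_mul_sum_sqDiff (f : V → ℝ) {u v : V} (p : G.Walk u v) :
    (f u - f v) ^ 2 ≤ p.length * (p.edges.map (sqDiff f)).sum := by
  induction p with
  | nil => simp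
  | @cons u w v h p ih =>
    have hS : 0 ≤ (p.edges.map (sqDiff f)).sum := by
      refine List.sum_nonneg fun x hx => ?_
      obtain ⟨e, -, rfl⟩ := List.mem_map.1 hx
      exact sqDiff_nonneg f e
    simp only [SimpleGraph.Walk.length_cons, SimpleGraph.Walk.edges_cons, List.map_cons,
      List.sum_cons, sqDiff_mk, Nat.cast_add, Nat.cast_one]
    set S := (p.edges.map (sqDiff f)).sum
    set k : ℝ := (p.length : ℝ) with hk
    have hk0 : 0 ≤ k := Nat.cast_nonneg _
    have hcross : 2 * ((f u - f w) * (f w - f v)) ≤ k * (f u - f w) ^ 2 + S := by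
      refine le_of_sq_le_sq ?_ (by positivity)
      nlinarith [sq_nonneg (k * (f u - f w) ^ 2 - S),
        mul_le_mul_of_nonneg_left ih (sq_nonneg (f u - f w))]
    nlinarith

variable [Fintype V] [DecidableEq V] (G) [DecidableRel G.Adj]

lemma dotProduct_lapMatrix_mulVec_eq_sum_sqDiff (f : V → ℝ) :
    f ⬝ᵥ (G.lapMatrix ℝ *ᵥ f) = ∑ e ∈ G.edgeFinset, sqDiff f e := by
  rw [← Matrix.toLinearMap₂'_apply', G.lapMatrix_toLinearMap₂' ℝ]
  have hdart : (∑ i : V, ∑ j : V, if G.Adj i j then (f i - f j) ^ 2 else 0) =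
      ∑ d : G.Dart, sqDiff f d.edge := by
    rw [← Finset.sum_product', ← Finset.sum_filter]
    symm
    refine Finset.sum_bij (fun d _ => d.toProd) ?_ ?_ ?_ ?_
    · intro d _
      simp
    · intro d _ d' _ h
      exact SimpleGraph.Dart.ext _ _ h
    · intro p hp
      exact ⟨⟨p, by simpa using hp⟩, Finset.mem_univ _, rfl⟩
    · intro d _
      rfl
  have hfib : ∑ d : G.Dart, sqDiff f d.edge = ∑ e ∈ G.edgeFinset, 2 * sqDiff f e := by
    rw [← Finset.sum_fiberwise_of_maps_to (t := G.edgeFinset) (g := fun d : G.Dart => d.edge)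
      (fun d _ => by simp)]
    refine Finset.sum_congr rfl fun e he => ?_
    rw [Finset.sum_congr rfl (g := fun _ => sqDiff f e)
      (fun d hd => by rw [(Finset.mem_filter.1 hd).2]), Finset.sum_const,
      G.dart_edge_fiber_card e (by simpa using he)]
    simp
  rw [hdart, hfib, ← Finset.mul_sum]
  ring

/-- A nonzero Laplacian eigenvalue of a connected graph is at least `1 / (n (n - 1))`. -/
lemma one_le_mul_of_hasEigenvalue_lapMatrix (hconn : G.Connected) {σ : ℝ} (hσ : 0 < σ)
    (hev : Module.End.HasEigenvalue (Matrix.mulVecLin (G.lapMatrix ℝ)) σ) :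
    1 ≤ (Fintype.card V : ℝ) * ((Fintype.card V : ℝ) - 1) * σ := by
  obtain ⟨f, hf⟩ := hev.exists_hasEigenvector
  have hLf : G.lapMatrix ℝ *ᵥ f = σ • f := by simpa using hf.apply_eq_smul
  have hsum : ∑ v, f v = 0 := by
    have h0 : (fun _ => (1 : ℝ)) ⬝ᵥ (G.lapMatrix ℝ *ᵥ f) = 0 := by
      rw [Matrix.dotProduct_mulVec, ← Matrix.mulVec_transpose, (G.isSymm_lapMatrix ℝ).eq,
        G.lapMatrix_mulVec_const_eq_zero, zero_dotProduct]
    rw [hLf, dotProduct_smul, smul_eq_mul] at h0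
    simpa [dotProduct] using (mul_eq_zero.1 h0).resolve_left hσ.ne'
  have := hconn.nonempty
  obtain ⟨v, hv⟩ := Finite.exists_max fun v => f v ^ 2
  have hfv : 0 < f v ^ 2 := by
    by_contra! h
    refine hf.2 (funext fun w => ?_)
    exact pow_eq_zero_iff two_ne_zero |>.1 (le_antisymm ((hv w).trans h) (sq_nonneg _))
  obtain ⟨w, hw⟩ : ∃ w, f v * f w ≤ 0 := by
    by_contra! h
    have : 0 < ∑ w, f v * f w := Finset.sum_pos (fun w _ => h w) Finset.univ_nonempty
    rw [← Finset.mul_sum, hsum, mul_zero] at this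
    exact this.false
  obtain ⟨p, hp⟩ := (hconn.preconnected v w).exists_isPath
  have hE : (p.edges.map (sqDiff f)).sum ≤ σ * ∑ u, f u ^ 2 := by
    have hquad := dotProduct_lapMatrix_mulVec_eq_sum_sqDiff G f
    rw [hLf, dotProduct_smul, smul_eq_mul] at hquad
    have hdot : f ⬝ᵥ f = ∑ u, f u ^ 2 := by simp [dotProduct, sq]
    rw [← hdot, hquad, ← List.sum_toFinset _ hp.isTrail.edges_nodup]
    refine Finset.sum_le_sum_of_subset_of_nonneg (fun e he => ?_)
      fun e _ _ => sqDiff_nonneg f e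
    simpa using p.edges_subset_edgeSet (List.mem_toFinset.1 he)
  have hnorm : ∑ u, f u ^ 2 ≤ (Fintype.card V : ℝ) * f v ^ 2 := by
    simpa using Finset.sum_le_sum fun u (_ : u ∈ Finset.univ) => hv u
  have hlen : (p.length : ℝ) ≤ (Fintype.card V : ℝ) - 1 := by
    have : p.length + 1 ≤ Fintype.card V := hp.length_lt
    have : (p.length : ℝ) + 1 ≤ Fintype.card V := by exact_mod_cast this
    linarith
  have hlen0 : (0 : ℝ) ≤ p.length := Nat.cast_nonneg _
  have hdiff : f v ^ 2 ≤ (f v - f w) ^ 2 := by nlinarith [sq_nonneg (f w)]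
  refine le_of_mul_le_mul_right ?_ hfv
  calc 1 * f v ^ 2 ≤ (f v - f w) ^ 2 := by rwa [one_mul]
    _ ≤ p.length * (p.edges.map (sqDiff f)).sum := p.sq_sub_le_length_mul_sum_sqDiff f
    _ ≤ p.length * (σ * ((Fintype.card V : ℝ) * f v ^ 2)) := by gcongr; exact hE.trans (by gcongr)
    _ ≤ ((Fintype.card V : ℝ) - 1) * (σ * ((Fintype.card V : ℝ) * f v ^ 2)) := by gcongr
    _ = _ := by ring

end LaplacianGap

section Jacobian

variable {V : Type*} [Fintype V] [DecidableEq V] (G : SimpleGraph V) [DecidableRel G.Adj] {d : ℕ}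
  {φ : ℕ → WithLp 2 (EuclideanSpace ℝ (Fin d) × EuclideanSpace ℝ (Fin d)) →
    EuclideanSpace ℝ (Fin d)}
  {ψ : ℕ → EuclideanSpace ℝ (Fin d) → EuclideanSpace ℝ (Fin d)}

lemma norm_toLp_prod_le {E F : Type*} [NormedAddCommGroup E] [NormedAddCommGroup F] (a : E)
    (b : F) : ‖WithLp.toLp 2 (a, b)‖ ≤ ‖a‖ + ‖b‖ := by
  rw [WithLp.prod_norm_eq_of_L2]
  refine Real.sqrt_le_iff.2 ⟨by positivity, ?_⟩
  simp only [WithLp.toLp_fst, WithLp.toLp_snd]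
  nlinarith [mul_nonneg (norm_nonneg a) (norm_nonneg b)]

lemma hasFDerivAt_gnn_succ (hφ : ∀ l, Differentiable ℝ (φ l)) (hψ : ∀ l, Differentiable ℝ (ψ l))
    (X : V → EuclideanSpace ℝ (Fin d)) (v : V) (l : ℕ) (y : EuclideanSpace ℝ (Fin d))
    (D : V → EuclideanSpace ℝ (Fin d) →L[ℝ] EuclideanSpace ℝ (Fin d))
    (hD : ∀ u, HasFDerivAt (fun y => gnn G d φ ψ l (Function.update X v y) u) (D u) y) (u : V) :
    HasFDerivAt (fun y => gnn G d φ ψ (l + 1) (Function.update X v y) u)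
      ((fderiv ℝ (φ l) (WithLp.toLp 2 (gnn G d φ ψ l (Function.update X v y) u,
          ∑ w, nadj G w u • ψ l (gnn G d φ ψ l (Function.update X v y) w)))).comp
        ((WithLp.prodContinuousLinearEquiv 2 ℝ _ _).symm.toContinuousLinearMap.comp
          ((D u).prod (∑ w, nadj G w u •
            (fderiv ℝ (ψ l) (gnn G d φ ψ l (Function.update X v y) w)).comp (D w))))) y := by
  have hsum := HasFDerivAt.fun_sum (u := Finset.univ) fun w _ =>
    (((hψ l _).hasFDerivAt.comp y (hD w)).const_smul (nadj G w u))
  have hpair := (WithLp.prodContinuousLinearEquiv 2 ℝ _ _).symm.toContinuousLinearMap.hasFDerivAt.comp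
    y ((hD u).prodMk hsum)
  exact (hφ l _).hasFDerivAt.comp y hpair

lemma differentiable_gnn_update (hφ : ∀ l, Differentiable ℝ (φ l))
    (hψ : ∀ l, Differentiable ℝ (ψ l)) (X : V → EuclideanSpace ℝ (Fin d)) (v : V) (l : ℕ) (u : V) :
    Differentiable ℝ (fun y => gnn G d φ ψ l (Function.update X v y) u) := by
  induction l generalizing u with
  | zero =>
    by_cases h : u = v
    · subst h
      simp [gnn]
    · simp [gnn, Function.update_of_ne h]
  | succ l ih =>
    exact fun y => (hasFDerivAt_gnn_succ G hφ hψ X v l y _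
      (fun w => (ih w y).hasFDerivAt) u).differentiableAt

lemma norm_fderiv_gnn_le (hφ : ∀ l, Differentiable ℝ (φ l)) (hψ : ∀ l, Differentiable ℝ (ψ l))
    {α β : ℝ} (hφα : ∀ l p, ‖fderiv ℝ (φ l) p‖ ≤ α) (hψβ : ∀ l p, ‖fderiv ℝ (ψ l) p‖ ≤ β)
    (hβ : 1 ≤ β) (X : V → EuclideanSpace ℝ (Fin d)) (v : V) (l : ℕ) (u : V)
    (y : EuclideanSpace ℝ (Fin d)) :
    ‖fderiv ℝ (fun y => gnn G d φ ψ l (Function.update X v y) u) y‖ ≤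
      (α * β) ^ l * ((1 + nadj G) ^ l) u v := by
  have hα : 0 ≤ α := (norm_nonneg _).trans (hφα 0 0)
  have hβ0 : 0 ≤ β := zero_le_one.trans hβ
  induction l generalizing u with
  | zero =>
    by_cases h : u = v
    · subst h
      simpa [gnn] using ContinuousLinearMap.norm_id_le
    · simp [gnn, Function.update_of_ne h, Matrix.one_apply_ne h]
  | succ l ih =>
    rw [(hasFDerivAt_gnn_succ G hφ hψ X v l y _
      (fun w => (differentiable_gnn_update G hφ hψ X v l w y).hasFDerivAt) u).fderiv]
    set D := fun w => fderiv ℝ (fun y => gnn G d φ ψ l (Function.update X v y) w) y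
    have hS : ‖∑ w, nadj G w u •
        (fderiv ℝ (ψ l) (gnn G d φ ψ l (Function.update X v y) w)).comp (D w)‖ ≤
        β * ∑ w, nadj G u w * ‖D w‖ := by
      refine (norm_sum_le _ _).trans ?_
      rw [Finset.mul_sum]
      refine Finset.sum_le_sum fun w _ => ?_
      rw [norm_smul, Real.norm_of_nonneg (nadj_nonneg G w u), nadj_comm G w u]
      calc _ ≤ nadj G u w * (β * ‖D w‖) := by
            refine mul_le_mul_of_nonneg_left ?_ (nadj_nonneg G u w)
            refine (ContinuousLinearMap.opNorm_comp_le _ _).trans ?_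
            gcongr
            exact hψβ _ _
        _ = _ := by ring
    have hpair (P Q : EuclideanSpace ℝ (Fin d) →L[ℝ] EuclideanSpace ℝ (Fin d)) :
        ‖(WithLp.prodContinuousLinearEquiv 2 ℝ _ _).symm.toContinuousLinearMap.comp (P.prod Q)‖ ≤
          ‖P‖ + ‖Q‖ := by
      refine ContinuousLinearMap.opNorm_le_bound _ (by positivity) fun z => ?_
      refine (norm_toLp_prod_le (P z) (Q z)).trans ?_
      rw [add_mul]
      exact add_le_add (P.le_opNorm z) (Q.le_opNorm z)
    calc _ ≤ α * (‖D u‖ + β * ∑ w, nadj G u w * ‖D w‖) := by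
          refine (ContinuousLinearMap.opNorm_comp_le _ _).trans ?_
          exact mul_le_mul (hφα _ _) ((hpair _ _).trans (by gcongr)) (norm_nonneg _) hα
      _ ≤ α * (β * ‖D u‖ + β * ∑ w, nadj G u w * ‖D w‖) := by
          gcongr
          exact le_mul_of_one_le_left (norm_nonneg _) hβ
      _ = (α * β) * (‖D u‖ + ∑ w, nadj G u w * ‖D w‖) := by ring
      _ ≤ (α * β) * ((α * β) ^ l * ((1 + nadj G) ^ l) u v +
            ∑ w, nadj G u w * ((α * β) ^ l * ((1 + nadj G) ^ l) w v)) := by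
          gcongr with w
          · exact ih u
          · exact nadj_nonneg G u w
          · exact ih w
      _ = _ := by
          rw [pow_succ' (1 + nadj G), add_mul, one_mul, Matrix.add_apply, Matrix.mul_apply,
            pow_succ, mul_add, mul_add, Finset.mul_sum, Finset.mul_sum]
          congr 1
          · ring
          · exact Finset.sum_congr rfl fun w _ => by ring

end Jacobian

/-- spectral-gap bound on the total Jacobian of a GNN. Here `σ₂` is the
second-smallest eigenvalue of the (unnormalized) Laplacian `L`; since `G` is connected, `σ₂` is
characterized as the smallest nonzero eigenvalue of `L` and is positive. Then
`Σ_{u ≠ v} ‖∂h_u^{(r)}/∂x_v‖ ≤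
(2αβ)^r · (d_max/2) · ((n(n−1)/d_min)(r + 1 + μ^{r+1}/(1−μ)) − 1/(n σ₂))`. -/
theorem total_jacobian_bound_by_spectral_gap {V : Type*} [Fintype V] [DecidableEq V]
    (G : SimpleGraph V) [DecidableRel G.Adj]
    (hconn : G.Connected) (hnonbip : ¬ G.Colorable 2) (hcard : 2 ≤ Fintype.card V)
    (μ : ℝ) (hμ0 : 0 ≤ μ) (hμ1 : μ < 1)
    (hspec : ∀ t : ℝ, Module.End.HasEigenvalue (Matrix.mulVecLin (nadjr G)) t → |t| ≤ μ)
    (σ₂ : ℝ) (hσpos : 0 < σ₂)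
    (hσeig : Module.End.HasEigenvalue (Matrix.mulVecLin (G.lapMatrix ℝ)) σ₂)
    (hσmin : ∀ t : ℝ, Module.End.HasEigenvalue (Matrix.mulVecLin (G.lapMatrix ℝ)) t →
      t ≠ 0 → σ₂ ≤ t)
    (dmin dmax : ℕ)
    (hdmin : IsLeast (Set.range fun v : V => G.degree v) dmin)
    (hdmax : IsGreatest (Set.range fun v : V => G.degree v) dmax)
    (d r : ℕ)
    (φ : ℕ → WithLp 2 (EuclideanSpace ℝ (Fin d) × EuclideanSpace ℝ (Fin d)) →
      EuclideanSpace ℝ (Fin d))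
    (ψ : ℕ → EuclideanSpace ℝ (Fin d) → EuclideanSpace ℝ (Fin d))
    (α β : ℝ)
    (hφdiff : ∀ l, ContDiff ℝ 1 (φ l))
    (hψdiff : ∀ l, ContDiff ℝ 1 (ψ l))
    (hφ : ∀ l p, ‖fderiv ℝ (φ l) p‖ ≤ α)
    (hψ : ∀ l p, ‖fderiv ℝ (ψ l) p‖ ≤ β)
    (hβ : 1 ≤ β)
    (X : V → EuclideanSpace ℝ (Fin d)) :
    ∑ p ∈ Finset.univ.offDiag,
        ‖fderiv ℝ (fun y => gnn G d φ ψ r (Function.update X p.2 y) p.1) (X p.2)‖ ≤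
      (2 * α * β) ^ r * ((dmax : ℝ) / 2) *
        (((Fintype.card V : ℝ) * ((Fintype.card V : ℝ) - 1) / (dmin : ℝ)) *
            ((r : ℝ) + 1 + μ ^ (r + 1) / (1 - μ)) -
          1 / ((Fintype.card V : ℝ) * σ₂)) := by
  have hn : 3 ≤ Fintype.card V := by
    by_contra! h
    exact hnonbip (G.colorable_of_fintype.mono (by omega))
  have hα : 0 ≤ α := (norm_nonneg _).trans (hφ 0 0)
  have hαβ : 0 ≤ α * β := mul_nonneg hα (zero_le_one.trans hβ)
  set n : ℝ := (Fintype.card V : ℝ) with hn_def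
  have hn3 : (3 : ℝ) ≤ n := by
    rw [hn_def]
    exact_mod_cast hn
  obtain ⟨⟨v₀, hv₀⟩, -⟩ := hdmin
  have hd1 : 1 ≤ (dmin : ℝ) := by
    have : Nontrivial V := Fintype.one_lt_card_iff_nontrivial.1 (by omega)
    have : 0 < dmin := hv₀ ▸ hconn.preconnected.degree_pos_of_nontrivial v₀
    exact_mod_cast this
  have hdn : (dmin : ℝ) ≤ n - 1 := by
    have : dmin + 1 ≤ Fintype.card V := hv₀ ▸ G.degree_lt_card_verts v₀
    have : (dmin : ℝ) + 1 ≤ n := by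
      rw [hn_def]
      exact_mod_cast this
    linarith
  have hdd : (dmin : ℝ) ≤ dmax := by
    exact_mod_cast hdmax.2 ⟨v₀, hv₀⟩
  have hgap : 1 / (n * σ₂) ≤ n - 1 := by
    rw [div_le_iff₀ (by positivity)]
    linarith [one_le_mul_of_hasEigenvalue_lapMatrix G hconn hσpos hσeig]
  have hμr : 0 ≤ μ ^ (r + 1) / (1 - μ) := div_nonneg (by positivity) (by linarith)
  have hbracket : (n - 1) * (n * (r + 1) / dmin - 1) ≤
      n * (n - 1) / dmin * (r + 1 + μ ^ (r + 1) / (1 - μ)) - 1 / (n * σ₂) := by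
    have h : 0 ≤ n * (n - 1) / dmin * (μ ^ (r + 1) / (1 - μ)) :=
      mul_nonneg (div_nonneg (mul_nonneg (by linarith) (by linarith)) (by linarith)) hμr
    have h2 : (n - 1) * (n * (r + 1) / dmin - 1) =
      n * (n - 1) / dmin * (r + 1) - (n - 1) := by ring
    rw [h2, mul_add]
    linarith
  rcases Nat.eq_zero_or_pos r with rfl | hr
  · have hzero : ∑ p ∈ (Finset.univ : Finset V).offDiag,
        ‖fderiv ℝ (fun y => gnn G d φ ψ 0 (Function.update X p.2 y) p.1) (X p.2)‖ = 0 := by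
      refine Finset.sum_eq_zero fun p hp => ?_
      simp [gnn, Function.update_of_ne (Finset.mem_offDiag.1 hp).2.2]
    rw [hzero]
    refine mul_nonneg (by positivity) (le_trans (mul_nonneg (by linarith) ?_) hbracket)
    rw [sub_nonneg, one_le_div (by linarith)]
    push_cast
    linarith
  · have hJ : ∑ p ∈ (Finset.univ : Finset V).offDiag,
        ‖fderiv ℝ (fun y => gnn G d φ ψ r (Function.update X p.2 y) p.1) (X p.2)‖ ≤
        (2 * α * β) ^ r * n := by
      calc _ ≤ ∑ p ∈ (Finset.univ : Finset V).offDiag,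
            (α * β) ^ r * ((1 + nadj G) ^ r) p.1 p.2 :=
            Finset.sum_le_sum fun p _ => norm_fderiv_gnn_le G
              (fun l => (hφdiff l).differentiable one_ne_zero)
              (fun l => (hψdiff l).differentiable one_ne_zero) hφ hψ hβ X p.2 r p.1 _
        _ ≤ ∑ p : V × V, (α * β) ^ r * ((1 + nadj G) ^ r) p.1 p.2 :=
            Finset.sum_le_univ_sum_of_nonneg fun p =>
              mul_nonneg (by positivity) (one_add_nadj_pow_nonneg G r p.1 p.2)
        _ = (α * β) ^ r * ∑ u, ∑ v, ((1 + nadj G) ^ r) u v := by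
            rw [← Finset.mul_sum, Fintype.sum_prod_type]
        _ ≤ (α * β) ^ r * (2 ^ r * n) := by
            gcongr
            exact sum_one_add_nadj_pow_le G r
        _ = _ := by rw [mul_assoc 2, mul_pow 2]; ring
    refine hJ.trans ?_
    rw [mul_assoc ((2 * α * β) ^ r)]
    refine mul_le_mul_of_nonneg_left ?_ (pow_nonneg (by linarith) r)
    have hr1 : (1 : ℝ) ≤ r := by exact_mod_cast hr
    have hquot : 2 * n - dmin ≤ dmin * (n * (r + 1) / dmin - 1) := by
      have : dmin * (n * (r + 1) / dmin - 1) = n * (r + 1) - dmin := by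
        field_simp
      rw [this]
      nlinarith
    have hpos : 0 ≤ n * (r + 1) / dmin - 1 := by
      by_contra! h
      nlinarith
    calc n ≤ (n - 1) * (n + 1) / 2 := by nlinarith
      _ ≤ (n - 1) * (dmin * (n * (r + 1) / dmin - 1)) / 2 := by
          gcongr
          · linarith
          · linarith
      _ = (dmin / 2) * ((n - 1) * (n * (r + 1) / dmin - 1)) := by ring
      _ ≤ (dmax / 2) * ((n - 1) * (n * (r + 1) / dmin - 1)) := by
          have : 0 ≤ (n - 1) * (n * (r + 1) / dmin - 1) := mul_nonneg (by linarith) hpos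
          gcongr
      _ ≤ _ := by gcongr
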